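/- Let d = 1 and let p, q be integers with q ≥ p ≥ 1. Fix i ∈ {1,…,p} and set r_i = i/2 if i is even and r_i = (i+1)/2 if i is odd. Then for every μ ∈ Λ⁺(B), the function λ ↦ (λ+i)^{r_i}·η_μ(λ) has a finite limit as λ → −i (along the punctured neighborhood of −i intersected with the domain of η_μ); moreover for μ = (0,…,0) this limit is nonzero. (That is, in the real case the poles of the cosine-λ transform at λ = −1,…,−p have orders i/2 for i even and (i+1)/2 for i odd.) -/

import Mathlib

open Filter Set

/-- `x` is a nonpositive integer (a pole of the Gamma function). -/
def IsNonposInt (x : ℝ) : Prop := ∃ k : ℕ, x = -(k : ℝ)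

/-- The eigenvalue `η_μ(λ)` of the cosine-λ transform on `Gr(p, 𝕂^{p+q})`
(`d = dim_ℝ 𝕂`) on the K-type of highest weight `μ = m`. -/
noncomputable def eta (d p q : ℕ) (m : Fin p → ℤ) (l : ℝ) : ℝ :=
  (-1 : ℝ) ^ ((∑ j, m j) / 2) *
    ((∏ j : Fin p,
        Real.Gamma ((d : ℝ) * ((p : ℝ) + (q : ℝ)) / 2 - (d : ℝ) * ((j : ℕ) : ℝ) / 2)) /
      (∏ j : Fin p, Real.Gamma ((d : ℝ) * (p : ℝ) / 2 - (d : ℝ) * ((j : ℕ) : ℝ) / 2))) *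
    (∏ j : Fin p,
      Real.Gamma ((d : ℝ) * (l + (p : ℝ)) / 2 - (d : ℝ) * ((j : ℕ) : ℝ) / 2) *
        Real.Gamma ((-(d : ℝ) * l + (m j : ℝ)) / 2 - (d : ℝ) * ((j : ℕ) : ℝ) / 2)) /
    (∏ j : Fin p,
      Real.Gamma (-(d : ℝ) * l / 2 - (d : ℝ) * ((j : ℕ) : ℝ) / 2) *
        Real.Gamma
          (((d : ℝ) * l + (d : ℝ) * ((p : ℝ) + (q : ℝ)) + (m j : ℝ)) / 2 -
            (d : ℝ) * ((j : ℕ) : ℝ) / 2))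

/-- Domain of `η_μ`: the set of real `λ` at which no Gamma argument appearing in the
formula for `η_μ(λ)` is a nonpositive integer. -/
def etaDom (d p q : ℕ) (m : Fin p → ℤ) : Set ℝ :=
  {l | ∀ j : Fin p,
    ¬ IsNonposInt ((d : ℝ) * (l + (p : ℝ)) / 2 - (d : ℝ) * ((j : ℕ) : ℝ) / 2) ∧
    ¬ IsNonposInt ((-(d : ℝ) * l + (m j : ℝ)) / 2 - (d : ℝ) * ((j : ℕ) : ℝ) / 2) ∧
    ¬ IsNonposInt (-(d : ℝ) * l / 2 - (d : ℝ) * ((j : ℕ) : ℝ) / 2) ∧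
    ¬ IsNonposInt
        (((d : ℝ) * l + (d : ℝ) * ((p : ℝ) + (q : ℝ)) + (m j : ℝ)) / 2 -
          (d : ℝ) * ((j : ℕ) : ℝ) / 2)}

/-- Membership in `Λ⁺(B)`: all `m_i` even, `m₁ ≥ m₂ ≥ ⋯ ≥ m_{p-1} ≥ |m_p|`, and
`m_p ≥ 0` unless `d = 1` and `p = q`. -/
def LambdaPlus (d p q : ℕ) (m : Fin p → ℤ) : Prop :=
  (∀ i, 2 ∣ m i) ∧ (∀ i j : Fin p, i < j → |m j| ≤ m i) ∧
    (¬(d = 1 ∧ p = q) → ∀ i, 0 ≤ m i)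

/-- The reciprocal of the real Gamma function is continuous everywhere, poles included. -/
theorem continuous_inv_realGamma : Continuous fun x : ℝ => (Real.Gamma x)⁻¹ := by
  have h : Continuous fun x : ℝ => ((Complex.Gamma (x : ℂ))⁻¹).re :=
    Complex.continuous_re.comp
      (Complex.differentiable_one_div_Gamma.continuous.comp Complex.continuous_ofReal)
  refine h.congr fun x => ?_
  rw [Complex.Gamma_ofReal, ← Complex.ofReal_inv, Complex.ofReal_re]

theorem continuousAt_realGamma {x : ℝ} (hx : ¬ IsNonposInt x) : ContinuousAt Real.Gamma x :=
  (Real.differentiableAt_Gamma fun k hk => hx ⟨k, hk⟩).continuousAt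

/-- The real Gamma function has simple poles at the nonpositive integers. -/
theorem exists_tendsto_mul_realGamma (k : ℕ) :
    ∃ c : ℝ, c ≠ 0 ∧
      Tendsto (fun t : ℝ => t * Real.Gamma (t - k)) (nhdsWithin 0 {0}ᶜ) (nhds c) := by
  induction k with
  | zero =>
    refine ⟨1, one_ne_zero, ?_⟩
    have h : ContinuousAt (fun t : ℝ => Real.Gamma (t + 1)) 0 := by
      refine ContinuousAt.comp (g := Real.Gamma) ?_ (by fun_prop)
      refine continuousAt_realGamma ?_
      rintro ⟨k, hk⟩
      have : (0 : ℝ) ≤ k := k.cast_nonneg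
      linarith
    have h1 : Tendsto (fun t : ℝ => Real.Gamma (t + 1)) (nhdsWithin 0 {0}ᶜ) (nhds 1) := by
      simpa [ContinuousAt] using h.tendsto.mono_left nhdsWithin_le_nhds
    refine h1.congr' ?_
    filter_upwards [self_mem_nhdsWithin] with t ht
    rw [Real.Gamma_add_one ht, Nat.cast_zero, sub_zero]
  | succ k ih =>
    obtain ⟨c, hc, h⟩ := ih
    have hk : (0 : ℝ) - (k + 1) ≠ 0 := by
      have : (0 : ℝ) ≤ k := k.cast_nonneg
      linarith
    have hlin : Tendsto (fun t : ℝ => t - (k + 1)) (nhdsWithin 0 {0}ᶜ) (nhds (0 - (k + 1))) :=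
      (Continuous.tendsto (by fun_prop) 0).mono_left nhdsWithin_le_nhds
    refine ⟨c / (0 - (k + 1)), div_ne_zero hc hk, (h.div hlin hk).congr' ?_⟩
    filter_upwards [hlin.eventually_ne hk] with t ht
    have hG := Real.Gamma_add_one ht
    rw [show t - (k + 1) + 1 = t - (k : ℝ) by ring] at hG
    simp only [Pi.div_apply, Nat.cast_add, Nat.cast_one]
    rw [hG]
    field_simp

/-- The simple poles of the Gamma function, after an affine change of variable. -/
theorem exists_tendsto_sub_mul_realGamma {f : ℝ → ℝ} {a s : ℝ} (hs : s ≠ 0)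
    (hf : ∀ l, f l = f a + s * (l - a)) (hfa : IsNonposInt (f a)) :
    ∃ c : ℝ, c ≠ 0 ∧
      Tendsto (fun l : ℝ => (l - a) * Real.Gamma (f l)) (nhdsWithin a {a}ᶜ) (nhds c) := by
  obtain ⟨k, hk⟩ := hfa
  obtain ⟨c, hc, h⟩ := exists_tendsto_mul_realGamma k
  have hlin : Tendsto (fun l : ℝ => s * (l - a)) (nhdsWithin a {a}ᶜ) (nhdsWithin 0 {0}ᶜ) := by
    refine tendsto_nhdsWithin_iff.2 ⟨?_, ?_⟩
    · have : Continuous fun l : ℝ => s * (l - a) := by fun_prop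
      simpa using (this.tendsto a).mono_left nhdsWithin_le_nhds
    · filter_upwards [self_mem_nhdsWithin] with l hl
      exact mul_ne_zero hs (sub_ne_zero.2 hl)
  refine ⟨s⁻¹ * c, mul_ne_zero (inv_ne_zero hs) hc,
    ((h.comp hlin).const_mul s⁻¹).congr fun l => ?_⟩
  rw [Function.comp_apply, hf l, hk, neg_add_eq_sub]
  field_simp

theorem tendsto_realGamma_comp {f : ℝ → ℝ} {a : ℝ} (hf : Continuous f)
    (hfa : ¬ IsNonposInt (f a)) :
    Tendsto (fun l => Real.Gamma (f l)) (nhdsWithin a {a}ᶜ) (nhds (Real.Gamma (f a))) :=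
  ((continuousAt_realGamma hfa).comp hf.continuousAt).tendsto.mono_left nhdsWithin_le_nhds

/-- A quotient of Gamma functions of affine arguments of nonzero slope has a finite limit at a
point where every pole of the numerator is a pole of the denominator. -/
theorem exists_tendsto_realGamma_div {f g : ℝ → ℝ} {a s : ℝ} (hs : s ≠ 0)
    (hf : ∀ l, f l = f a + s * (l - a)) (hg : ∀ l, g l = g a + s * (l - a))
    (hfg : IsNonposInt (f a) → IsNonposInt (g a)) :
    ∃ c : ℝ, Tendsto (fun l => Real.Gamma (f l) * (Real.Gamma (g l))⁻¹)
      (nhdsWithin a {a}ᶜ) (nhds c) := by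
  by_cases h : IsNonposInt (f a)
  · obtain ⟨b, -, hb⟩ := exists_tendsto_sub_mul_realGamma hs hf h
    obtain ⟨c, hc, hc'⟩ := exists_tendsto_sub_mul_realGamma hs hg (hfg h)
    refine ⟨b / c, (hb.div hc' hc).congr' ?_⟩
    filter_upwards [self_mem_nhdsWithin] with l hl
    have : l - a ≠ 0 := sub_ne_zero.2 hl
    rw [Pi.div_apply, mul_div_mul_left _ _ this, div_eq_mul_inv]
  · have hf' : Continuous f := by
      rw [funext hf]
      fun_prop
    have hg' : Continuous g := by
      rw [funext hg]
      fun_prop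
    exact ⟨_, (tendsto_realGamma_comp hf' h).mul
      (((continuous_inv_realGamma.comp hg').tendsto a).mono_left nhdsWithin_le_nhds)⟩

theorem realGamma_ne_zero {x : ℝ} (hx : ¬ IsNonposInt x) : Real.Gamma x ≠ 0 :=
  Real.Gamma_ne_zero fun k hk => hx ⟨k, hk⟩

/-- Half an integer `z` is a nonpositive integer iff `z` is even and nonpositive. -/
theorem isNonposInt_half_iff {x : ℝ} (z : ℤ) (hx : x = (z : ℝ) / 2) :
    IsNonposInt x ↔ z ≤ 0 ∧ 2 ∣ z := by
  subst hx
  constructor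
  · rintro ⟨k, hk⟩
    have : z = -(2 * (k : ℤ)) := by
      have h : (z : ℝ) = -(2 * (k : ℝ)) := by linarith
      exact_mod_cast h
    omega
  · rintro ⟨h0, w, rfl⟩
    refine ⟨(-w).toNat, ?_⟩
    have h : (((-w).toNat : ℤ) : ℝ) = ((-w : ℤ) : ℝ) := by
      rw [Int.toNat_of_nonneg (by omega)]
    rw [Int.cast_natCast] at h
    rw [h]
    push_cast
    ring

theorem isNonposInt_numerator_iff {p i : ℕ} (j : ℕ) :
    IsNonposInt ((-(i : ℝ) + (p : ℝ)) / 2 - (j : ℝ) / 2) ↔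
      (p : ℤ) - i - j ≤ 0 ∧ (2 : ℤ) ∣ (p : ℤ) - i - j :=
  isNonposInt_half_iff _ (by push_cast; ring)

theorem card_numerator_poles {p i : ℕ} (hip : i ≤ p) :
    ({j : Fin p | (p : ℤ) - i - (j : ℕ) ≤ 0 ∧ (2 : ℤ) ∣ (p : ℤ) - i - (j : ℕ)} :
      Finset (Fin p)).card = (i + 1) / 2 := by
  rw [← Finset.card_range ((i + 1) / 2)]
  refine Finset.card_bij (fun j _ => ((j : ℕ) - (p - i)) / 2) ?_ ?_ ?_
  · intro j hj
    have := j.isLt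
    simp only [Finset.mem_filter, Finset.mem_univ, true_and, Finset.mem_range] at hj ⊢
    omega
  · intro j hj k hk h
    simp only [Finset.mem_filter, Finset.mem_univ, true_and] at hj hk
    ext
    omega
  · intro t ht
    rw [Finset.mem_range] at ht
    refine ⟨⟨p - i + 2 * t, by omega⟩, ?_, ?_⟩
    · simp only [Finset.mem_filter, Finset.mem_univ, true_and]
      omega
    · simp only []
      omega

/-- The product of the factors `Γ((λ + p - j) / 2)` has a pole of order exactly `⌈i / 2⌉`
at `λ = -i`. -/
theorem exists_tendsto_pow_mul_prod_realGamma {p i : ℕ} (hip : i ≤ p) :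
    ∃ c : ℝ, c ≠ 0 ∧
      Tendsto (fun l : ℝ => (l + (i : ℝ)) ^ ((i + 1) / 2) *
          ∏ j : Fin p, Real.Gamma ((l + (p : ℝ)) / 2 - ((j : ℕ) : ℝ) / 2))
        (nhdsWithin (-(i : ℝ)) {-(i : ℝ)}ᶜ) (nhds c) := by
  have key : ∀ j : Fin p, ∃ c : ℝ, c ≠ 0 ∧
      Tendsto (fun l : ℝ =>
          (if (p : ℤ) - i - (j : ℕ) ≤ 0 ∧ (2 : ℤ) ∣ (p : ℤ) - i - (j : ℕ)
            then l + (i : ℝ) else 1) *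
          Real.Gamma ((l + (p : ℝ)) / 2 - ((j : ℕ) : ℝ) / 2))
        (nhdsWithin (-(i : ℝ)) {-(i : ℝ)}ᶜ) (nhds c) := by
    intro j
    split_ifs with h
    · obtain ⟨c, hc, hlim⟩ := exists_tendsto_sub_mul_realGamma
        (f := fun l => (l + (p : ℝ)) / 2 - ((j : ℕ) : ℝ) / 2) (a := -(i : ℝ))
        (s := 1 / 2) (by norm_num) (fun l => by ring) ((isNonposInt_numerator_iff _).2 h)
      refine ⟨c, hc, ?_⟩
      simpa only [sub_neg_eq_add] using hlim
    · have h' := mt (isNonposInt_numerator_iff _).1 h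
      refine ⟨_, realGamma_ne_zero h', ?_⟩
      simp only [one_mul]
      exact tendsto_realGamma_comp
        (f := fun l => (l + (p : ℝ)) / 2 - ((j : ℕ) : ℝ) / 2) (by fun_prop) h'
  choose c hc hlim using key
  refine ⟨∏ j, c j, Finset.prod_ne_zero_iff.2 fun j _ => hc j,
    (tendsto_finsetProd _ fun j _ => hlim j).congr fun l => ?_⟩
  rw [Finset.prod_mul_distrib, Finset.prod_ite, Finset.prod_const, Finset.prod_const_one, mul_one,
    card_numerator_poles hip]

/-- In the real case, a pole of the numerator factor `Γ((-λ + m_j - j) / 2)` at `λ = -i` is a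
pole of `Γ((-λ - j) / 2)`. -/
theorem LambdaPlus.isNonposInt_of_shift {p q : ℕ} {m : Fin p → ℤ} (hm : LambdaPlus 1 p q m)
    {i : ℕ} (hip : i ≤ p) (j : Fin p)
    (h : IsNonposInt ((- -(i : ℝ) + (m j : ℝ)) / 2 - ((j : ℕ) : ℝ) / 2)) :
    IsNonposInt (- -(i : ℝ) / 2 - ((j : ℕ) : ℝ) / 2) := by
  have h1 := (isNonposInt_half_iff ((i : ℤ) + m j - (j : ℕ)) (by push_cast; ring)).1 h
  refine (isNonposInt_half_iff ((i : ℤ) - (j : ℕ)) (by push_cast; ring)).2 ?_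
  have h2 := hm.1 j
  have hj := j.isLt
  refine ⟨?_, by omega⟩
  rcases lt_or_ge ((j : ℕ) + 1) p with hlt | hge
  · have h3 := (abs_nonneg _).trans
      (hm.2.1 j ⟨(j : ℕ) + 1, hlt⟩ (Fin.lt_def.2 (Nat.lt_succ_self _)))
    omega
  · omega

/-- The eigenvalue in the real case, with its factors grouped for the pole analysis. -/
theorem eta_one_eq (p q : ℕ) (m : Fin p → ℤ) (l : ℝ) :
    eta 1 p q m l =
      ((-1 : ℝ) ^ ((∑ j, m j) / 2) *
        ((∏ j : Fin p, Real.Gamma (((p : ℝ) + (q : ℝ)) / 2 - ((j : ℕ) : ℝ) / 2)) /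
          (∏ j : Fin p, Real.Gamma ((p : ℝ) / 2 - ((j : ℕ) : ℝ) / 2)))) *
      (∏ j : Fin p, Real.Gamma ((l + (p : ℝ)) / 2 - ((j : ℕ) : ℝ) / 2)) *
      (∏ j : Fin p, Real.Gamma ((-l + (m j : ℝ)) / 2 - ((j : ℕ) : ℝ) / 2) *
        (Real.Gamma (-l / 2 - ((j : ℕ) : ℝ) / 2))⁻¹) *
      ∏ j : Fin p,
        (Real.Gamma ((l + ((p : ℝ) + (q : ℝ)) + (m j : ℝ)) / 2 - ((j : ℕ) : ℝ) / 2))⁻¹ := by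
  simp only [eta, Nat.cast_one, one_mul, neg_mul, Finset.prod_mul_distrib, Finset.prod_inv_distrib,
    div_eq_mul_inv, mul_inv]
  ring

theorem tendsto_prod_inv_realGamma (p q : ℕ) (m : Fin p → ℤ) (a : ℝ) :
    Tendsto (fun l : ℝ => ∏ j : Fin p,
        (Real.Gamma ((l + ((p : ℝ) + (q : ℝ)) + (m j : ℝ)) / 2 - ((j : ℕ) : ℝ) / 2))⁻¹)
      (nhdsWithin a {a}ᶜ)
      (nhds (∏ j : Fin p,
        (Real.Gamma ((a + ((p : ℝ) + (q : ℝ)) + (m j : ℝ)) / 2 - ((j : ℕ) : ℝ) / 2))⁻¹)) :=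
  tendsto_finsetProd _ fun j _ =>
    ((continuous_inv_realGamma.comp (f := fun l : ℝ =>
      (l + ((p : ℝ) + (q : ℝ)) + (m j : ℝ)) / 2 - ((j : ℕ) : ℝ) / 2)
      (by fun_prop)).tendsto a).mono_left nhdsWithin_le_nhds

/-- in the real case (d = 1) the pole of the cosine-λ transform at
`λ = -i` (1 ≤ i ≤ p) has order `i/2` for `i` even, `(i+1)/2` for `i` odd. -/
theorem pole_orders_real_case
    (p q : ℕ) (hp : 1 ≤ p) (hpq : p ≤ q)
    (i : ℕ) (hi1 : 1 ≤ i) (hip : i ≤ p)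
    (r : ℕ) (hr : r = if Even i then i / 2 else (i + 1) / 2) :
    (∀ m : Fin p → ℤ, LambdaPlus 1 p q m →
      ∃ c : ℝ, Tendsto (fun l : ℝ => (l + (i : ℝ)) ^ r * eta 1 p q m l)
        (nhdsWithin (-(i : ℝ)) (etaDom 1 p q m \ {-(i : ℝ)})) (nhds c)) ∧
    (∃ c : ℝ, c ≠ 0 ∧
      Tendsto (fun l : ℝ => (l + (i : ℝ)) ^ r * eta 1 p q (fun _ => 0) l)
        (nhdsWithin (-(i : ℝ)) (etaDom 1 p q (fun _ => 0) \ {-(i : ℝ)})) (nhds c)) := by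
  have hr' : r = (i + 1) / 2 := by
    rw [hr]
    split_ifs with h
    · obtain ⟨k, rfl⟩ := h
      omega
    · rfl
  subst hr'
  obtain ⟨a, ha, hA⟩ := exists_tendsto_pow_mul_prod_realGamma hip
  constructor
  · intro m hm
    have hB : ∀ j : Fin p, ∃ c : ℝ,
        Tendsto (fun l : ℝ => Real.Gamma ((-l + (m j : ℝ)) / 2 - ((j : ℕ) : ℝ) / 2) *
            (Real.Gamma (-l / 2 - ((j : ℕ) : ℝ) / 2))⁻¹)
          (nhdsWithin (-(i : ℝ)) {-(i : ℝ)}ᶜ) (nhds c) := fun j =>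
      exists_tendsto_realGamma_div
        (f := fun l => (-l + (m j : ℝ)) / 2 - ((j : ℕ) : ℝ) / 2)
        (g := fun l => -l / 2 - ((j : ℕ) : ℝ) / 2) (s := -1 / 2) (by norm_num)
        (fun l => by ring) (fun l => by ring) (hm.isNonposInt_of_shift hip j)
    choose b hb using hB
    refine ⟨_, ((((hA.const_mul ((-1 : ℝ) ^ ((∑ j, m j) / 2) *
        ((∏ j : Fin p, Real.Gamma (((p : ℝ) + (q : ℝ)) / 2 - ((j : ℕ) : ℝ) / 2)) /
          (∏ j : Fin p, Real.Gamma ((p : ℝ) / 2 - ((j : ℕ) : ℝ) / 2))))).mul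
        (tendsto_finsetProd Finset.univ fun j _ => hb j)).mul
      (tendsto_prod_inv_realGamma p q m (-(i : ℝ)))).mono_left
        (nhdsWithin_mono _ fun l hl => hl.2)).congr fun l => ?_⟩
    rw [eta_one_eq]
    ring
  · have hpos : ∀ j : Fin p, ((j : ℕ) : ℝ) + 1 ≤ p := fun j => by exact_mod_cast j.isLt
    have hpq' : (p : ℝ) ≤ q := by exact_mod_cast hpq
    have hip' : (i : ℝ) ≤ p := by exact_mod_cast hip
    have hD := tendsto_prod_inv_realGamma p q (fun _ => 0) (-(i : ℝ))
    refine ⟨_, ?_, (((hA.const_mul ((-1 : ℝ) ^ ((∑ _j : Fin p, (0 : ℤ)) / 2) *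
        ((∏ j : Fin p, Real.Gamma (((p : ℝ) + (q : ℝ)) / 2 - ((j : ℕ) : ℝ) / 2)) /
          (∏ j : Fin p, Real.Gamma ((p : ℝ) / 2 - ((j : ℕ) : ℝ) / 2))))).mul hD).mono_left
        (nhdsWithin_mono _ fun l hl => hl.2)).congr' ?_⟩
    · refine mul_ne_zero (mul_ne_zero (mul_ne_zero (zpow_ne_zero _ (by norm_num))
        (div_ne_zero ?_ ?_)) ha) ?_ <;>
      refine Finset.prod_ne_zero_iff.2 fun j _ => ?_
      · exact (Real.Gamma_pos_of_pos (by have := hpos j; linarith)).ne'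
      · exact (Real.Gamma_pos_of_pos (by have := hpos j; linarith)).ne'
      · refine inv_ne_zero (Real.Gamma_pos_of_pos ?_).ne'
        have := hpos j
        push_cast
        linarith
    · filter_upwards [self_mem_nhdsWithin] with l hl
      have h1 : ∏ j : Fin p, (Real.Gamma ((-l + ((0 : ℤ) : ℝ)) / 2 - ((j : ℕ) : ℝ) / 2) *
          (Real.Gamma (-l / 2 - ((j : ℕ) : ℝ) / 2))⁻¹) = 1 := by
        refine Finset.prod_eq_one fun j _ => ?_
        have h := (hl.1 j).2.2.1
        simp only [Nat.cast_one, one_mul, neg_mul] at h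
        rw [Int.cast_zero, add_zero, mul_inv_cancel₀ (realGamma_ne_zero h)]
      rw [eta_one_eq, h1]
      ring
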